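/- arXiv:2509.17028 — 3 statements merged into one kernel-verified Lean document; each statement's English description precedes it below -/
import Mathlib

section
/- A packetized work-conserving FIFO server of constant bit rate c offers the strict service curve β(t) = c·max(t − l^M/c, 0), where l^M is the maximum packet length. Concretely: let c > 0, let packets n = 1, 2, ... arrive at times 0 ≤ a(1) ≤ a(2) ≤ ... with lengths 0 < l(n) ≤ l^M, and let departures satisfy d(0) = 0 and d(n) = max(a(n), d(n − 1)) + l(n)/c; let A(t) = Σ_{n : a(n) < t} l(n), A*(t) = Σ_{n : d(n) < t} l(n), and B(t) = A(t) − A*(t). Then for all 0 ≤ s ≤ t, if B(u) > 0 for all u ∈ (s, t], then A*(t) − A*(s) ≥ c·max(t − s − l^M/c, 0). -/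
/-- Departure times of a packetized work-conserving FIFO server of constant bit
rate `c`: `d(0) = 0` and `d(n+1) = max(a(n+1), d(n)) + l(n+1)/c`, where `a` gives
the times the packets become available and `len` their lengths. -/
noncomputable def dep (c : ℝ) (a len : ℕ → ℝ) : ℕ → ℝ
  | 0 => 0
  | n + 1 => max (a (n + 1)) (dep c a len n) + len (n + 1) / c

section PacketServer

variable {c : ℝ} {a len : ℕ → ℝ}

theorem arrival_add_le_dep (n : ℕ) : a (n + 1) + len (n + 1) / c ≤ dep c a len (n + 1) := by
  rw [dep]
  gcongr
  exact le_max_left _ _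

theorem dep_monotone (hc : 0 < c) (hlen : ∀ n, 1 ≤ n → 0 < len n) :
    Monotone (dep c a len) := by
  refine monotone_nat_of_le_succ fun n => ?_
  have h1 : 0 < len (n + 1) / c := div_pos (hlen _ (by omega)) hc
  have h2 := le_max_right (a (n + 1)) (dep c a len n)
  rw [dep]
  linarith

theorem arrival_le_dep (hc : 0 < c) (hlen : ∀ n, 1 ≤ n → 0 < len n) (n : ℕ) :
    a (n + 1) ≤ dep c a len (n + 1) := by
  have h1 : 0 < len (n + 1) / c := div_pos (hlen _ (by omega)) hc
  have h2 := arrival_add_le_dep (c := c) (a := a) (len := len) n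
  linarith

/-- If exactly the first `k` packets have event times before `u`, the cumulative count at `u`
is the total length of these packets. -/
theorem tsum_ite_lt_eq_sum_range {f : ℕ → ℝ} {u : ℝ} (hlen0 : len 0 = 0) (k : ℕ)
    (hlt : ∀ j, 1 ≤ j → j ≤ k → f j < u) (hge : ∀ j, k + 1 ≤ j → u ≤ f j) :
    (∑' n : ℕ, if f n < u then len n else 0) = ∑ n ∈ Finset.range (k + 1), len n := by
  rw [tsum_eq_sum (s := Finset.range (k + 1))]
  · refine Finset.sum_congr rfl fun j hj => ?_
    rcases Nat.eq_zero_or_pos j with rfl | hpos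
    · simp [hlen0]
    · rw [if_pos (hlt j hpos (by simpa [Nat.lt_succ_iff] using hj))]
  · intro j hj
    rw [if_neg (not_lt.2 (hge j (by simpa using hj)))]

/-- If no packet is in the system at time `u`, with packets up to `k` departed before `u` and
packets from `k + 1` on arriving at `u` or later, the backlog at `u` is nonpositive. -/
theorem tsum_arrival_le_tsum_dep (hc : 0 < c) (hlen0 : len 0 = 0)
    (hlen : ∀ n, 1 ≤ n → 0 < len n) (hamono : ∀ n, 1 ≤ n → a n ≤ a (n + 1)) {u : ℝ} {k : ℕ}
    (hd : dep c a len k < u) (ha : u ≤ a (k + 1)) :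
    (∑' n : ℕ, if a n < u then len n else 0) ≤
      ∑' n : ℕ, if dep c a len n < u then len n else 0 := by
  have hmono := dep_monotone (a := a) hc hlen
  have hge : ∀ j, k + 1 ≤ j → u ≤ a j := by
    intro j hj
    induction j, hj using Nat.le_induction with
    | base => exact ha
    | succ j hj ih => exact ih.trans (hamono j (by omega))
  have hdlt : ∀ j, 1 ≤ j → j ≤ k → dep c a len j < u :=
    fun j _ hj => (hmono hj).trans_lt hd
  have hle : ∀ j, 1 ≤ j → a j ≤ dep c a len j := by
    intro j hj
    obtain ⟨i, rfl⟩ := Nat.exists_eq_add_of_le' hj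
    exact arrival_le_dep hc hlen i
  rw [tsum_ite_lt_eq_sum_range hlen0 k (fun j h1 h2 => (hle j h1).trans_lt (hdlt j h1 h2)) hge,
    tsum_ite_lt_eq_sum_range hlen0 k hdlt
      fun j hj => (hge j hj).trans (hle j (by omega))]

end PacketServer

/-- A packetized work-conserving FIFO server of constant bit rate
`c` offers the strict service curve `β(t) = c·(t − l^M/c)⁺`, where `l^M` is the
maximum packet length: whenever the backlog `B(u) = A(u) − A*(u)` is positive
throughout `(s, t]`, `A*(t) − A*(s) ≥ c·max(t − s − l^M/c, 0)`. -/
theorem corrected_strict_service_curve_CBR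
    (c lM : ℝ) (hc : 0 < c)
    (a len : ℕ → ℝ)
    (ha1 : 0 ≤ a 1) (hamono : ∀ n, 1 ≤ n → a n ≤ a (n + 1))
    (hlen0 : len 0 = 0)
    (hlen : ∀ n, 1 ≤ n → 0 < len n ∧ len n ≤ lM)
    (A Astar B : ℝ → ℝ)
    (hA : ∀ t, A t = ∑' n : ℕ, if a n < t then len n else 0)
    (hAstar : ∀ t, Astar t = ∑' n : ℕ, if dep c a len n < t then len n else 0)
    (hB : ∀ t, B t = A t - Astar t) :
    ∀ s t, 0 ≤ s → s ≤ t → (∀ u, s < u → u ≤ t → 0 < B u) →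
      c * max (t - s - lM / c) 0 ≤ Astar t - Astar s := by
  have hpos : ∀ n, 1 ≤ n → 0 < len n := fun n hn => (hlen n hn).1
  have hmono := dep_monotone (a := a) hc hpos
  have hlM : 0 < lM := (hlen 1 le_rfl).1.trans_le (hlen 1 le_rfl).2
  intro s t hs hst hback
  rcases hst.eq_or_lt with rfl | hlt
  · have : 0 < lM / c := div_pos hlM hc
    rw [max_eq_right (by linarith)]
    simp
  have hext : ∃ j, t ≤ dep c a len (j + 1) := by
    by_contra! hall
    have h := hback t hlt le_rfl
    rw [hB, hA, hAstar] at h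
    refine h.ne' (sub_eq_zero.2 (tsum_congr fun n => ?_))
    rcases n with _ | n
    · simp [hlen0]
    · rw [if_pos (hall n), if_pos ((arrival_le_dep hc hpos n).trans_lt (hall n))]
  have hexs : ∃ j, s ≤ dep c a len (j + 1) := hext.imp fun j hj => hst.trans hj
  classical
  -- `k` and `m` count the packets departed before `s` and `t`.
  obtain ⟨k, hk, hkmin⟩ : ∃ k, s ≤ dep c a len (k + 1) ∧ ∀ j < k, dep c a len (j + 1) < s :=
    ⟨Nat.find hexs, Nat.find_spec hexs, fun j hj => not_le.1 (Nat.find_min hexs hj)⟩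
  obtain ⟨m, hm, hmmin⟩ : ∃ m, t ≤ dep c a len (m + 1) ∧ ∀ j < m, dep c a len (j + 1) < t :=
    ⟨Nat.find hext, Nat.find_spec hext, fun j hj => not_le.1 (Nat.find_min hext hj)⟩
  have hkm : k ≤ m := by
    by_contra! h
    linarith [hkmin m h]
  have hAs : Astar s = ∑ n ∈ Finset.range (k + 1), len n := by
    rw [hAstar]
    refine tsum_ite_lt_eq_sum_range hlen0 k (fun j h1 h2 => ?_) fun j hj => hk.trans (hmono hj)
    obtain ⟨i, rfl⟩ := Nat.exists_eq_add_of_le' h1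
    exact hkmin i h2
  have hAt : Astar t = ∑ n ∈ Finset.range (m + 1), len n := by
    rw [hAstar]
    refine tsum_ite_lt_eq_sum_range hlen0 m (fun j h1 h2 => ?_) fun j hj => hm.trans (hmono hj)
    obtain ⟨i, rfl⟩ := Nat.exists_eq_add_of_le' h1
    exact hmmin i h2
  have hdk : dep c a len k ≤ s := by
    rcases k with _ | k
    · simpa [dep] using hs
    · exact (hkmin k (by omega)).le
  have hdt : ∀ j ≤ m, dep c a len j < t := by
    intro j hj
    rcases j with _ | j
    · simpa [dep] using hs.trans_lt hlt
    · exact hmmin j hj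
  have harr : ∀ j ≤ m, a (j + 1) ≤ max s (dep c a len j) := by
    intro j hj
    by_contra! h
    obtain ⟨h1, h2⟩ := max_lt_iff.1 h
    have hb := hback (min (a (j + 1)) t) (lt_min h1 hlt) (min_le_right _ _)
    rw [hB, hA, hAstar] at hb
    linarith [tsum_arrival_le_tsum_dep hc hlen0 hpos hamono (lt_min h2 (hdt j hj))
      (min_le_left _ _)]
  have hbusy : ∀ j, k ≤ j → j ≤ m + 1 → max s (dep c a len j) ≤
      s + (∑ n ∈ Finset.range (j + 1), len n - ∑ n ∈ Finset.range (k + 1), len n) / c := by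
    intro j hj
    induction j, hj using Nat.le_induction with
    | base => simp [hdk]
    | succ j hj ih =>
      intro hjm
      have h1 := ih (by omega)
      have h2 := max_le (harr j (by omega)) (le_max_right s (dep c a len j))
      have h3 : 0 < len (j + 1) / c := div_pos (hpos _ (by omega)) hc
      have h4 := le_max_left s (dep c a len j)
      rw [Finset.sum_range_succ _ (j + 1), add_sub_right_comm, add_div, dep]
      refine max_le ?_ ?_ <;> linarith
  have hfin := (hm.trans (le_max_right s _)).trans (hbusy (m + 1) (by omega) le_rfl)
  rw [Finset.sum_range_succ _ (m + 1), ← hAs, ← hAt, ← sub_le_iff_le_add', le_div_iff₀ hc] at hfin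
  rw [mul_max_of_nonneg _ _ hc.le, mul_zero, mul_sub, mul_div_cancel₀ _ hc.ne']
  refine max_le (by linarith [(hlen (m + 1) (by omega)).2]) ?_
  rw [hAs, hAt, sub_nonneg]
  refine Finset.sum_le_sum_of_subset_of_nonneg
    (Finset.range_mono (by omega)) fun j _ _ => ?_
  rcases Nat.eq_zero_or_pos j with rfl | hj
  · exact hlen0.ge
  · exact (hpos j hj).le
end

section
/- Backlog bound for the highest priority queue of a packetized non-preemptive strict priority server with token-bucket constrained input: let c > 0, L ≥ 0, let high-priority packets n = 1, 2, ... arrive at times 0 ≤ a(1) ≤ a(2) ≤ ... with lengths 0 < l(n) ≤ l^M, with departures d(0) = 0 and d(n) = max(a(n) + w(n), d(n − 1)) + l(n)/c, where w(n) ∈ [0, L/c] and w(n) = 0 whenever a(n) < d(n − 1); let A(t) = Σ_{n : a(n) < t} l(n), A*(t) = Σ_{n : d(n) < t} l(n), and B(t) = A(t) − A*(t). If A(t) − A(s) ≤ ρ·(t − s) + σ for all 0 ≤ s ≤ t with 0 ≤ ρ ≤ c and σ ≥ 0, then for all t ≥ 0, B(t) ≤ σ + (ρ/c)·(l^M + L).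 -/
/-- A packet departs no earlier than it becomes available, once its length is nonnegative. -/
lemma le_dep {c : ℝ} (hc : 0 < c) {a len : ℕ → ℝ} {n : ℕ} (hn : 1 ≤ n) (hlen : 0 ≤ len n) :
    a n ≤ dep c a len n := by
  obtain ⟨k, rfl⟩ := Nat.exists_eq_add_of_le' hn
  have h : 0 ≤ len (k + 1) / c := div_nonneg hlen hc.le
  rw [dep]
  linarith [le_max_left (a (k + 1)) (dep c a len k)]

/-- The packet `k` that starts the busy period of packet `m` bounds the departure time of `m`. -/
lemma exists_dep_le_busy_period {c L : ℝ} (hL : 0 ≤ L / c) {a w len : ℕ → ℝ} (ha1 : 0 ≤ a 1)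
    (hw : ∀ n, 1 ≤ n → w n ≤ L / c)
    (hw0 : ∀ n, a (n + 1) < dep c (fun k => a k + w k) len n → w (n + 1) = 0)
    {m : ℕ} (hm : 1 ≤ m) :
    ∃ k, 1 ≤ k ∧ k ≤ m ∧
      dep c (fun k => a k + w k) len m ≤
        a k + L / c + (∑ i ∈ Finset.Ico k (m + 1), len i) / c := by
  induction m, hm using Nat.le_induction with
  | base =>
    refine ⟨1, le_rfl, le_rfl, ?_⟩
    have := hw 1 le_rfl
    have : max (a 1 + w 1) 0 ≤ a 1 + L / c := max_le (by linarith) (by linarith)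
    simpa [dep] using this
  | succ n hn ih =>
    obtain h | h := lt_or_ge (a (n + 1)) (dep c (fun k => a k + w k) len n)
    · obtain ⟨k, hk1, hkn, hk⟩ := ih
      refine ⟨k, hk1, by omega, ?_⟩
      rw [Finset.sum_Ico_succ_top (by omega), add_div, dep, hw0 n h, add_zero,
        max_eq_right h.le]
      linarith
    · refine ⟨n + 1, by omega, le_rfl, ?_⟩
      have := hw (n + 1) (by omega)
      have : max (a (n + 1) + w (n + 1)) (dep c (fun k => a k + w k) len n)
          ≤ a (n + 1) + L / c := max_le (by linarith) (by linarith)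
      simpa [dep] using this

/-- Backlog bound for the highest priority queue of a packetized
non-preemptive strict priority server with token-bucket constrained input: if
`A(t) − A(s) ≤ ρ·(t − s) + σ` for all `0 ≤ s ≤ t` with `0 ≤ ρ ≤ c` and `σ ≥ 0`,
then for all `t ≥ 0` the backlog satisfies `B(t) ≤ σ + (ρ/c)·(l^M + L)`. -/
theorem backlog_bound_SP
    (c L lM ρ σ : ℝ) (hc : 0 < c) (hL : 0 ≤ L)
    (a w len : ℕ → ℝ)
    (ha1 : 0 ≤ a 1) (hamono : ∀ n, 1 ≤ n → a n ≤ a (n + 1))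
    (hlen0 : len 0 = 0)
    (hlen : ∀ n, 1 ≤ n → 0 < len n ∧ len n ≤ lM)
    (hw : ∀ n, 1 ≤ n → 0 ≤ w n ∧ w n ≤ L / c)
    (hw0 : ∀ n, a (n + 1) < dep c (fun k => a k + w k) len n → w (n + 1) = 0)
    (A Astar B : ℝ → ℝ)
    (hA : ∀ t, A t = ∑' n : ℕ, if a n < t then len n else 0)
    (hAstar : ∀ t, Astar t =
      ∑' n : ℕ, if dep c (fun k => a k + w k) len n < t then len n else 0)
    (hB : ∀ t, B t = A t - Astar t)
    (hρ0 : 0 ≤ ρ) (hρc : ρ ≤ c) (hσ : 0 ≤ σ)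
    (harr : ∀ s t, 0 ≤ s → s ≤ t → A t - A s ≤ ρ * (t - s) + σ) :
    ∀ t, 0 ≤ t → B t ≤ σ + (ρ / c) * (lM + L) := by
  intro t _
  have hbound : 0 ≤ ρ / c * (lM + L) :=
    mul_nonneg (div_nonneg hρ0 hc.le) (by linarith [hlen 1 le_rfl])
  have hlen_nonneg : ∀ n, 0 ≤ len n := fun n => by
    rcases Nat.eq_zero_or_pos n with rfl | hn
    · exact hlen0.ge
    · exact (hlen n hn).1.le
  have hmono : ∀ i j, 1 ≤ i → i ≤ j → a i ≤ a j := fun i j hi hij => by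
    induction j, hij using Nat.le_induction with
    | base => exact le_rfl
    | succ n hn ih => exact ih.trans (hamono n (hi.trans hn))
  have hle_dep : ∀ n, 1 ≤ n → a n ≤ dep c (fun k => a k + w k) len n := fun n hn =>
    (le_add_of_nonneg_right (hw n hn).1).trans
      (le_dep (a := fun k => a k + w k) hc hn (hlen_nonneg n))
  set d := dep c (fun k => a k + w k) len with hd
  rw [hB]
  have hg_nonneg : ∀ n, 0 ≤ if d n < t then len n else 0 := fun n => by
    split_ifs <;> simp [hlen_nonneg]
  have hAstar_nonneg : 0 ≤ Astar t := by
    rw [hAstar]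
    exact tsum_nonneg hg_nonneg
  by_cases hf : Summable fun n => if a n < t then len n else 0
  swap
  · rw [hA, tsum_eq_zero_of_not_summable hf]
    linarith
  have hg : Summable fun n => if d n < t then len n else 0 := by
    refine hf.of_nonneg_of_le hg_nonneg fun n => ?_
    rcases Nat.eq_zero_or_pos n with rfl | hn
    · simp [hlen0]
    · have := hle_dep n hn
      have := hlen_nonneg n
      split_ifs <;> linarith
  by_cases hex : ∃ n, 1 ≤ n ∧ a n < t ∧ t ≤ d n
  swap
  · push Not at hex
    have : A t ≤ Astar t := by
      rw [hA, hAstar]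
      refine hf.tsum_le_tsum (fun n => ?_) hg
      rcases Nat.eq_zero_or_pos n with rfl | hn
      · simp [hlen0]
      · have := hex n hn
        have := hlen_nonneg n
        split_ifs <;> grind
    linarith
  classical
  obtain ⟨m, ⟨hm1, hmt, htm⟩, hmin⟩ :
      ∃ m, (1 ≤ m ∧ a m < t ∧ t ≤ d m) ∧ ∀ j < m, ¬(1 ≤ j ∧ a j < t ∧ t ≤ d j) :=
    ⟨Nat.find hex, Nat.find_spec hex, fun _ => Nat.find_min hex⟩
  have hserved : ∀ j, 1 ≤ j → j < m → d j < t := fun j hj hjm => by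
    by_contra! h
    exact hmin j hjm ⟨hj, (hmono j m hj hjm.le).trans_lt hmt, h⟩
  obtain ⟨k, hk1, hkm, hk⟩ := exists_dep_le_busy_period (div_nonneg hL hc.le) ha1
    (fun n hn => (hw n hn).2) hw0 hm1
  rw [← hd, Finset.sum_Ico_succ_top hkm] at hk
  have hakt : a k ≤ t := (hmono k m hk1 hkm).trans hmt.le
  have hak : 0 ≤ a k := ha1.trans (hmono 1 k le_rfl hk1)
  have hpart : Summable fun n => if a n < a k then len n else 0 := by
    refine hf.of_nonneg_of_le (fun n => ?_) fun n => ?_ <;>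
    · have := hlen_nonneg n
      split_ifs <;> linarith
  have hsum : HasSum (fun n => if n ∈ Finset.Ico k m then len n else 0)
      (∑ i ∈ Finset.Ico k m, len i) := by
    have h : HasSum (fun n => if n ∈ Finset.Ico k m then len n else 0) _ :=
      hasSum_sum_of_ne_finset_zero (s := Finset.Ico k m) fun n hn => if_neg hn
    rwa [Finset.sum_congr rfl fun n hn => if_pos hn] at h
  have hsplit : A (a k) + ∑ i ∈ Finset.Ico k m, len i ≤ Astar t := by
    rw [hA, hAstar]
    refine hasSum_le (fun n => ?_) (hpart.hasSum.add hsum) hg.hasSum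
    rcases Nat.eq_zero_or_pos n with rfl | hn
    · simp [hlen0]
    · have h1 := hlen_nonneg n
      have h2 := hserved n hn
      have h3 := hmono k n hk1
      simp only [Finset.mem_Ico]
      split_ifs <;> grind
  have hS : 0 ≤ ∑ i ∈ Finset.Ico k m, len i := Finset.sum_nonneg fun i _ => hlen_nonneg i
  have hlm := (hlen m hm1).2
  have harr' := harr (a k) t hak hakt
  set S := ∑ i ∈ Finset.Ico k m, len i
  have hdur : t - a k ≤ (S + (lM + L)) / c := by
    have : (S + len m) / c + L / c ≤ (S + (lM + L)) / c := by
      rw [← add_div]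
      exact div_le_div_of_nonneg_right (by linarith) hc.le
    linarith
  have hrate : ρ * (t - a k) ≤ ρ / c * S + ρ / c * (lM + L) :=
    (mul_le_mul_of_nonneg_left hdur hρ0).trans_eq (by ring)
  have hratio : ρ / c * S ≤ S := mul_le_of_le_one_left hS ((div_le_one hc).2 hρc)
  linarith
end

section
/- Concatenation service curve for two packetized non-preemptive strict priority servers in tandem where the flow has highest priority at both: let c1, c2 > 0 and L ≥ 0, let the flow's packets n = 1, 2, ... arrive at times 0 ≤ a(1) ≤ a(2) ≤ ... with lengths 0 < l(n) ≤ l^M, with departure recursions d1(0) = d2(0) = 0, d1(n) = max(a(n) + w1(n), d1(n − 1)) + l(n)/c1 and d2(n) = max(d1(n) + w2(n), d2(n − 1)) + l(n)/c2, where for i = 1, 2, wi(n) ∈ [0, L/ci] and wi(n) = 0 whenever the packet arrives at server i before di(n − 1) (non-preemptive blocking by a lower-priority packet only when the high-priority queue is empty at arrival); let A(t) = Σ_{n : a(n) < t} l(n) and A*₂(t) = Σ_{n : d2(n) < t} l(n). Then for all t ≥ 0, A*₂(t) ≥ inf_{0 ≤ s ≤ t} { A(s) + min(c1, c2)·max(t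 − s − (l^M + L)/c1 − (l^M + L)/c2, 0) }; i.e., the tandem offers the service curve min(c1, c2)·(t − (l^M + L)/c1 − (l^M + L)/c2)^+. -/
open Finset in
theorem exists_dep_succ_eq (c : ℝ) (a len : ℕ → ℝ) (ha : 0 ≤ a 1) (n : ℕ) :
    ∃ k ≤ n, dep c a len (n + 1) =
      a (k + 1) + (∑ i ∈ range (n + 2), len i - ∑ i ∈ range (k + 1), len i) / c := by
  induction n with
  | zero =>
    refine ⟨0, le_rfl, ?_⟩
    simp [dep, ha, sum_range_succ]
  | succ n ih =>
    obtain ⟨k, hk, h⟩ := ih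
    rw [dep]
    rcases le_total (a (n + 1 + 1)) (dep c a len (n + 1)) with h' | h'
    · refine ⟨k, hk.trans n.le_succ, ?_⟩
      rw [max_eq_right h', h, sum_range_succ _ (n + 2)]
      ring
    · refine ⟨n + 1, le_rfl, ?_⟩
      rw [max_eq_left h', sum_range_succ _ (n + 2)]
      ring

theorem dep_mono {c : ℝ} (hc : 0 < c) (a : ℕ → ℝ) {len : ℕ → ℝ} (hlen : ∀ n, 0 ≤ len n) :
    Monotone (dep c a len) :=
  monotone_nat_of_le_succ fun n => by
    rw [dep]
    exact (le_max_right _ _).trans (le_add_of_nonneg_right (div_nonneg (hlen _) hc.le))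

open Finset in
theorem sum_range_succ_div_le_dep (c : ℝ) (a : ℕ → ℝ) {len : ℕ → ℝ} (hlen0 : len 0 = 0) (n : ℕ) :
    (∑ i ∈ range (n + 1), len i) / c ≤ dep c a len n := by
  induction n with
  | zero => simp [dep, hlen0]
  | succ n ih =>
    rw [dep, sum_range_succ, add_div]
    gcongr
    exact ih.trans (le_max_right _ _)

theorem summable_of_dep_lt {c : ℝ} (hc : 0 < c) (a : ℕ → ℝ) {len : ℕ → ℝ} (hlen0 : len 0 = 0)
    (hlen : ∀ n, 0 ≤ len n) {t : ℝ} (h : ∀ n, dep c a len n < t) : Summable len := by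
  refine summable_of_sum_range_le (c := t * c) hlen fun n => ?_
  have h1 := (sum_range_succ_div_le_dep c a hlen0 n).trans (h n).le
  rw [div_le_iff₀ hc, Finset.sum_range_succ] at h1
  linarith [hlen n]

open Finset in
/-- If packet `m + 1` is the first one with `t ≤ d (m + 1)`, exactly the packets up to `m` are
counted before `t`. -/
theorem tsum_ite_lt_eq_sum_range_s18 {d len : ℕ → ℝ} {t : ℝ} {m : ℕ}
    (hlt : ∀ n ≤ m, d n < t) (hle : ∀ n, m < n → t ≤ d n) :
    (∑' n, if d n < t then len n else 0) = ∑ i ∈ range (m + 1), len i := by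
  rw [tsum_eq_sum (s := range (m + 1))]
  · refine sum_congr rfl fun n hn => if_pos (hlt n ?_)
    simpa [Nat.lt_succ_iff] using hn
  · intro n hn
    exact if_neg (not_lt.2 (hle n (by simpa using hn)))

open Finset in
theorem tsum_ite_lt_le_sum_range {a len : ℕ → ℝ} {s : ℝ} {k : ℕ}
    (hlen : ∀ n, 0 ≤ len n) (hle : ∀ n, k < n → s ≤ a n) :
    (∑' n, if a n < s then len n else 0) ≤ ∑ i ∈ range (k + 1), len i := by
  rw [tsum_eq_sum (s := range (k + 1))]
  · refine sum_le_sum fun n _ => ?_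
    split_ifs
    exacts [le_rfl, hlen n]
  · intro n hn
    exact if_neg (not_lt.2 (hle n (by simpa using hn)))

open Finset in
/-- The last packet of each server's busy period contributes at most `lM / c`, the rest of the
traffic is served at rate at least `min c1 c2`. -/
theorem exists_dep_tandem_le {c1 c2 L lM : ℝ} (hc1 : 0 < c1) (hc2 : 0 < c2)
    {a w1 w2 len : ℕ → ℝ} (ha1 : 0 ≤ a 1) (hnonneg : ∀ n, 0 ≤ len n)
    (hlen : ∀ n, 1 ≤ n → len n ≤ lM)
    (hw1 : ∀ n, 1 ≤ n → 0 ≤ w1 n ∧ w1 n ≤ L / c1)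
    (hw2 : ∀ n, 1 ≤ n → 0 ≤ w2 n ∧ w2 n ≤ L / c2) (m : ℕ) :
    ∃ j ≤ m, dep c2 (fun k => dep c1 (fun j => a j + w1 j) len k + w2 k) len (m + 1) ≤
      a (j + 1) + (lM + L) / c1 + (lM + L) / c2 +
        (∑ i ∈ range (m + 1), len i - ∑ i ∈ range (j + 1), len i) / min c1 c2 := by
  have hmono := dep_mono hc1 (fun j => a j + w1 j) hnonneg
  have hS : Monotone fun n => ∑ i ∈ range n, len i := fun p q hpq =>
    sum_le_sum_of_subset_of_nonneg (range_mono hpq) fun i _ _ => hnonneg i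
  have hr : 0 < min c1 c2 := lt_min hc1 hc2
  obtain ⟨k, hk, h2⟩ := exists_dep_succ_eq c2
    (fun k => dep c1 (fun j => a j + w1 j) len k + w2 k) len
    (add_nonneg (hmono (Nat.zero_le 1)) (hw2 1 le_rfl).1) m
  obtain ⟨j, hj, h1⟩ := exists_dep_succ_eq c1 (fun j => a j + w1 j) len
    (add_nonneg ha1 (hw1 1 le_rfl).1) k
  refine ⟨j, hj.trans hk, ?_⟩
  rw [h2]
  simp only [h1]
  rw [sum_range_succ _ (k + 1), sum_range_succ _ (m + 1)]
  have e1 : (∑ i ∈ range (k + 1), len i - ∑ i ∈ range (j + 1), len i) / c1 ≤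
      (∑ i ∈ range (k + 1), len i - ∑ i ∈ range (j + 1), len i) / min c1 c2 :=
    div_le_div_of_nonneg_left (sub_nonneg.2 (hS (by omega))) hr (min_le_left _ _)
  have e2 : (∑ i ∈ range (m + 1), len i - ∑ i ∈ range (k + 1), len i) / c2 ≤
      (∑ i ∈ range (m + 1), len i - ∑ i ∈ range (k + 1), len i) / min c1 c2 :=
    div_le_div_of_nonneg_left (sub_nonneg.2 (hS (by omega))) hr (min_le_right _ _)
  have e3 : len (k + 1) / c1 ≤ lM / c1 := by gcongr; exact hlen _ (by omega)
  have e4 : len (m + 1) / c2 ≤ lM / c2 := by gcongr; exact hlen _ (by omega)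
  have e5 := (hw1 (j + 1) (by omega)).2
  have e6 := (hw2 (k + 1) (by omega)).2
  simp only [add_div, sub_div] at *
  linarith

/-- Concatenation service curve for two packetized non-preemptive
strict priority servers in tandem (rates `c1`, `c2`), where the flow has highest
priority at both: with `d1(n) = max(a(n) + w1(n), d1(n−1)) + l(n)/c1`,
`d2(n) = max(d1(n) + w2(n), d2(n−1)) + l(n)/c2`, `wi(n) ∈ [0, L/ci]` and
`wi(n) = 0` whenever the packet arrives at server `i` before `di(n−1)`, the
tandem offers the service curve
`min(c1, c2)·(t − (l^M + L)/c1 − (l^M + L)/c2)⁺`: for all `t ≥ 0`,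
`A*₂(t) ≥ inf_{0 ≤ s ≤ t} ( A(s) + min(c1,c2)·max(t − s − (l^M+L)/c1 − (l^M+L)/c2, 0) )`. -/
theorem concatenation_service_curve_SP
    (c1 c2 L lM : ℝ) (hc1 : 0 < c1) (hc2 : 0 < c2) (hL : 0 ≤ L)
    (a w1 w2 len : ℕ → ℝ)
    (ha1 : 0 ≤ a 1) (hamono : ∀ n, 1 ≤ n → a n ≤ a (n + 1))
    (hlen0 : len 0 = 0)
    (hlen : ∀ n, 1 ≤ n → 0 < len n ∧ len n ≤ lM)
    (hw1 : ∀ n, 1 ≤ n → 0 ≤ w1 n ∧ w1 n ≤ L / c1)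
    (hw2 : ∀ n, 1 ≤ n → 0 ≤ w2 n ∧ w2 n ≤ L / c2)
    (hw10 : ∀ n, a (n + 1) < dep c1 (fun k => a k + w1 k) len n → w1 (n + 1) = 0)
    (hw20 : ∀ n, dep c1 (fun k => a k + w1 k) len (n + 1) <
        dep c2 (fun k => dep c1 (fun j => a j + w1 j) len k + w2 k) len n →
      w2 (n + 1) = 0)
    (A Astar2 : ℝ → ℝ)
    (hA : ∀ t, A t = ∑' n : ℕ, if a n < t then len n else 0)
    (hAstar2 : ∀ t, Astar2 t = ∑' n : ℕ,
      if dep c2 (fun k => dep c1 (fun j => a j + w1 j) len k + w2 k) len n < t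
      then len n else 0) :
    ∀ t, 0 ≤ t →
      sInf ((fun s => A s +
          min c1 c2 * max (t - s - (lM + L) / c1 - (lM + L) / c2) 0) ''
        Set.Icc 0 t) ≤ Astar2 t := by
  intro t ht
  have hlen' : ∀ n, 0 ≤ len n := fun n => by
    rcases Nat.eq_zero_or_pos n with rfl | h
    exacts [hlen0.ge, (hlen n h).1.le]
  have hlM : 0 ≤ lM := (hlen' 1).trans (hlen 1 le_rfl).2
  have hr : 0 < min c1 c2 := lt_min hc1 hc2
  have hT1 : 0 ≤ (lM + L) / c1 := by positivity
  have hT2 : 0 ≤ (lM + L) / c2 := by positivity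
  have hA0 : ∀ s, 0 ≤ A s := fun s => by
    rw [hA]
    refine tsum_nonneg fun n => ?_
    split_ifs
    exacts [hlen' n, le_rfl]
  have hbdd : BddBelow ((fun s => A s +
      min c1 c2 * max (t - s - (lM + L) / c1 - (lM + L) / c2) 0) '' Set.Icc 0 t) := by
    refine ⟨0, ?_⟩
    rintro _ ⟨s, -, rfl⟩
    exact add_nonneg (hA0 s) (mul_nonneg hr.le (le_max_right _ _))
  suffices h : ∃ s ∈ Set.Icc 0 t, A s +
      min c1 c2 * max (t - s - (lM + L) / c1 - (lM + L) / c2) 0 ≤ Astar2 t by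
    obtain ⟨s, hs, hle⟩ := h
    exact (csInf_le hbdd ⟨s, hs, rfl⟩).trans hle
  have hat_t : A t + min c1 c2 * max (t - t - (lM + L) / c1 - (lM + L) / c2) 0 = A t := by
    rw [max_eq_right (by linarith), mul_zero, add_zero]
  have htandem := exists_dep_tandem_le hc1 hc2 ha1 hlen' (fun n hn => (hlen n hn).2) hw1 hw2
  have hd0 : dep c2 (fun k => dep c1 (fun j => a j + w1 j) len k + w2 k) len 0 = 0 := rfl
  have hd := dep_mono hc2 (fun k => dep c1 (fun j => a j + w1 j) len k + w2 k) hlen'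
  have hsum := fun h => summable_of_dep_lt hc2
    (fun k => dep c1 (fun j => a j + w1 j) len k + w2 k) hlen0 hlen' (t := t) h
  generalize dep c2 (fun k => dep c1 (fun j => a j + w1 j) len k + w2 k) len = d at *
  have ha : ∀ p q, 1 ≤ p → p ≤ q → a p ≤ a q := fun p q hp hpq =>
    Nat.le_induction le_rfl (fun n hn ih => ih.trans (hamono n (hp.trans hn))) q hpq
  by_cases hex : ∃ m, t ≤ d (m + 1)
  · classical
    set m := Nat.find hex with hm
    have hspec : t ≤ d (m + 1) := Nat.find_spec hex
    obtain ⟨j, hj, hle⟩ := htandem m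
    have hmin := fun s (hs : s ≤ a (j + 1)) =>
      tsum_ite_lt_le_sum_range (a := a) hlen'
        fun n (hn : j < n) => hs.trans (ha _ n (by omega) hn)
    have hS : ∑ i ∈ Finset.range (j + 1), len i ≤ ∑ i ∈ Finset.range (m + 1), len i :=
      Finset.sum_le_sum_of_subset_of_nonneg (Finset.range_mono (by omega)) fun i _ _ => hlen' i
    have hStar : ∑ i ∈ Finset.range (m + 1), len i ≤ Astar2 t := by
      rw [hAstar2]
      rcases ht.eq_or_lt with rfl | ht
      · have hm0 : m = 0 := by
          rw [hm, Nat.find_eq_zero]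
          exact hd0.ge.trans (hd (Nat.zero_le _))
        simp only [hm0, zero_add, Finset.sum_range_one, hlen0]
        refine tsum_nonneg fun n => ?_
        split_ifs
        exacts [hlen' n, le_rfl]
      · refine (tsum_ite_lt_eq_sum_range_s18 (fun n hn => ?_) fun n hn => hspec.trans (hd hn)).ge
        rcases n with _ | n
        · rwa [hd0]
        · exact not_le.1 (Nat.find_min hex hn)
    rcases le_total (a (j + 1)) t with hat | hat
    · refine ⟨a (j + 1), ⟨ha1.trans (ha _ _ le_rfl (by omega)), hat⟩, ?_⟩
      have h1 := hmin _ le_rfl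
      rw [← hA] at h1
      have h2 : min c1 c2 * max (t - a (j + 1) - (lM + L) / c1 - (lM + L) / c2) 0 ≤
          ∑ i ∈ Finset.range (m + 1), len i - ∑ i ∈ Finset.range (j + 1), len i := by
        rw [← le_div_iff₀' hr]
        exact max_le (by linarith) (div_nonneg (sub_nonneg.2 hS) hr.le)
      linarith
    · refine ⟨t, ⟨ht, le_rfl⟩, ?_⟩
      rw [hat_t, hA]
      exact (hmin t hat).trans (hS.trans hStar)
  · push Not at hex
    refine ⟨t, ⟨ht, le_rfl⟩, ?_⟩
    have hlt : ∀ n, d n < t := fun n => (hd n.le_succ).trans_lt (hex n)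
    rw [hat_t, hA, hAstar2]
    simp only [hlt, if_true]
    have hite : ∀ n, (if a n < t then len n else 0) ≤ len n := fun n => by
      split_ifs
      exacts [le_rfl, hlen' n]
    refine Summable.tsum_le_tsum hite (.of_nonneg_of_le (fun n => ?_) hite (hsum hlt)) (hsum hlt)
    split_ifs
    exacts [hlen' n, le_rfl]
end
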